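/- arXiv:2201.13158 — 2 statements merged into one kernel-verified Lean document; each statement's English description precedes it below -/
import Mathlib

section
/- (Indifference between players) Let i be a player and let j, k be two distinct players such that either j, k ∈ N⁺_i with j ∼_i k, or j, k ∈ N⁻_i with j ∼_i k, or j and k are both neutral for i (neither friends nor enemies of i). Then for every coalition C containing i with j ∉ C and k ∉ C it holds that δ(⊵_i, C ∪ {j}) = δ(⊵_i, C ∪ {k}), i.e., C ∪ {j} ⪰_i C ∪ {k} and C ∪ {k} ⪰_i C ∪ {j}. -/
/-! Basic machinery: weak orders, linear extensions, Kendall-tau,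
and the directed Hausdorff–Kendall-tau distance. -/

section Orders

variable {P : Type*}

/-- The strict part `x ▷ y` of a relation `R`. -/
def strictOf (R : P → P → Prop) (x y : P) : Prop := R x y ∧ ¬ R y x

/-- The indifference part `x ∼ y` of a relation `R`. -/
def indiffOf (R : P → P → Prop) (x y : P) : Prop := R x y ∧ R y x

/-- `R` is a weak order (total preorder) on the finite set `S`. -/
structure IsWeakOrderOn (S : Finset P) (R : P → P → Prop) : Prop where
  refl : ∀ x ∈ S, R x x
  trans : ∀ x ∈ S, ∀ y ∈ S, ∀ z ∈ S, R x y → R y z → R x z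
  total : ∀ x ∈ S, ∀ y ∈ S, R x y ∨ R y x

/-- `A` is a linear extension on `S` of the weak order `R`: a strict total
order on `S` which is consistent with the strict part of `R`. -/
structure IsLinExtOn (S : Finset P) (R : P → P → Prop) (A : P → P → Prop) : Prop where
  irrefl : ∀ x ∈ S, ¬ A x x
  trans : ∀ x ∈ S, ∀ y ∈ S, ∀ z ∈ S, A x y → A y z → A x z
  total : ∀ x ∈ S, ∀ y ∈ S, x ≠ y → A x y ∨ A y x
  extend : ∀ x ∈ S, ∀ y ∈ S, strictOf R x y → A x y

/-- The Kendall-tau distance between two strict (linear) orders on `S`: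
the number of pairs ordered oppositely by the two orders. -/
noncomputable def kendallTau (S : Finset P) (A B : P → P → Prop) : ℕ :=
  Set.ncard {p : P × P | p.1 ∈ S ∧ p.2 ∈ S ∧ A p.1 p.2 ∧ B p.2 p.1}

/-- The directed Hausdorff–Kendall-tau distance `→τ(R1,R2)` between weak orders on `S`:
the maximum over linear extensions `B` of `R2` of the minimum over linear
extensions `A` of `R1` of `τ(A,B)`. -/
noncomputable def dirTau (S : Finset P) (R1 R2 : P → P → Prop) : ℕ :=
  sSup { n : ℕ | ∃ B : P → P → Prop, IsLinExtOn S R2 B ∧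
    n = sInf { m : ℕ | ∃ A : P → P → Prop, IsLinExtOn S R1 A ∧ m = kendallTau S A B } }

/-- The (undirected) Hausdorff–Kendall-tau distance `τ*`. -/
noncomputable def hkTau (S : Finset P) (R1 R2 : P → P → Prop) : ℕ :=
  max (dirTau S R1 R2) (dirTau S R2 R1)

end Orders

/-! FEN-hedonic games with distance-based preferences. -/

section Game

/-- A FEN preference for player `i`: disjoint sets of friends and enemies
(not containing `i`) together with weak orders on the friends and on the enemies. -/
structure FENPref (P : Type*) (i : P) where
  friends : Finset P
  enemies : Finset P
  Rp : P → P → Prop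
  Rm : P → P → Prop
  disj : Disjoint friends enemies
  self_not_friend : i ∉ friends
  self_not_enemy : i ∉ enemies
  wo_p : IsWeakOrderOn friends Rp
  wo_m : IsWeakOrderOn enemies Rm

variable {P : Type*} {i : P}

/-- The weak order `⊵⁺_i` on `N⁺_i ∪ {i}`: the friends, ordered by `⊵_i`,
all strictly above `i`. -/
def FENPref.prefPlus (pr : FENPref P i) (x y : P) : Prop :=
  (x ∈ pr.friends ∧ y ∈ pr.friends ∧ pr.Rp x y) ∨
  (x ∈ pr.friends ∧ y = i) ∨
  (x = i ∧ y = i)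

/-- The weak order `⊵⁻_i` on `N⁻_i ∪ {i}`: `i` strictly above all enemies,
which are ordered by `⊵_i`. -/
def FENPref.prefMinus (pr : FENPref P i) (x y : P) : Prop :=
  (x = i ∧ y = i) ∨
  (x = i ∧ y ∈ pr.enemies) ∨
  (x ∈ pr.enemies ∧ y ∈ pr.enemies ∧ pr.Rm x y)

/-- The weak order `C⁺_i` on `N⁺_i ∪ {i}`: friends in `C` strictly above `i`,
ordered by `⊵_i`; friends not in `C` strictly below `i`, ordered by the reverse of `⊵_i`. -/
def FENPref.coalPlus (pr : FENPref P i) (C : Finset P) (x y : P) : Prop :=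
  (x ∈ pr.friends ∧ x ∈ C ∧ y ∈ pr.friends ∧ y ∈ C ∧ pr.Rp x y) ∨
  ((x ∈ pr.friends ∧ x ∈ C) ∧ (y = i ∨ (y ∈ pr.friends ∧ y ∉ C))) ∨
  (x = i ∧ (y = i ∨ (y ∈ pr.friends ∧ y ∉ C))) ∨
  (x ∈ pr.friends ∧ x ∉ C ∧ y ∈ pr.friends ∧ y ∉ C ∧ pr.Rp y x)

/-- The weak order `C⁻_i` on `N⁻_i ∪ {i}`: enemies in `C` strictly above `i`,
ordered by the reverse of `⊵_i`; enemies not in `C` strictly below `i`, ordered by `⊵_i`. -/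
def FENPref.coalMinus (pr : FENPref P i) (C : Finset P) (x y : P) : Prop :=
  (x ∈ pr.enemies ∧ x ∈ C ∧ y ∈ pr.enemies ∧ y ∈ C ∧ pr.Rm y x) ∨
  ((x ∈ pr.enemies ∧ x ∈ C) ∧ (y = i ∨ (y ∈ pr.enemies ∧ y ∉ C))) ∨
  (x = i ∧ (y = i ∨ (y ∈ pr.enemies ∧ y ∉ C))) ∨
  (x ∈ pr.enemies ∧ x ∉ C ∧ y ∈ pr.enemies ∧ y ∉ C ∧ pr.Rm x y)

variable [DecidableEq P]

/-- `δ⁺(⊵_i, C) = →τ(⊵⁺_i, C⁺_i)`. -/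
noncomputable def FENPref.deltaPlus (pr : FENPref P i) (C : Finset P) : ℕ :=
  dirTau (insert i pr.friends) pr.prefPlus (pr.coalPlus C)

/-- `δ⁻(⊵_i, C) = →τ(⊵⁻_i, C⁻_i)`. -/
noncomputable def FENPref.deltaMinus (pr : FENPref P i) (C : Finset P) : ℕ :=
  dirTau (insert i pr.enemies) pr.prefMinus (pr.coalMinus C)

/-- `δ(⊵_i, C) = δ⁺(⊵_i, C) + δ⁻(⊵_i, C)`. -/
noncomputable def FENPref.delta (pr : FENPref P i) (C : Finset P) : ℕ :=
  pr.deltaPlus C + pr.deltaMinus C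

end Game

section Relabelling

variable {P : Type*} {S : Finset P} {R R' R₁ R₁' R₂ R₂' : P → P → Prop}

theorem IsLinExtOn.onFun {A : P → P → Prop} (e : Equiv.Perm P) (he : ∀ x, e x ∈ S ↔ x ∈ S)
    (hR : ∀ x ∈ S, ∀ y ∈ S, (R (e x) (e y) ↔ R' x y)) (hA : IsLinExtOn S R A) :
    IsLinExtOn S R' (Function.onFun A e) where
  irrefl x hx := hA.irrefl _ ((he x).2 hx)
  trans x hx y hy z hz := hA.trans _ ((he x).2 hx) _ ((he y).2 hy) _ ((he z).2 hz)
  total x hx y hy hxy := hA.total _ ((he x).2 hx) _ ((he y).2 hy) (e.injective.ne hxy)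
  extend x hx y hy h := hA.extend _ ((he x).2 hx) _ ((he y).2 hy)
    ⟨(hR x hx y hy).2 h.1, fun h' => h.2 ((hR y hy x hx).1 h')⟩

theorem exists_onFun_isLinExtOn {A : P → P → Prop} (e : Equiv.Perm P)
    (he : ∀ x, e x ∈ S ↔ x ∈ S) (hR : ∀ x ∈ S, ∀ y ∈ S, (R (e x) (e y) ↔ R' x y))
    (hA : IsLinExtOn S R' A) : ∃ B, IsLinExtOn S R B ∧ A = Function.onFun B e := by
  have he' : ∀ x, e.symm x ∈ S ↔ x ∈ S := fun x => by rw [← he, e.apply_symm_apply]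
  refine ⟨Function.onFun A e.symm, hA.onFun e.symm he' fun x hx y hy => ?_, ?_⟩
  · simpa using (hR _ ((he' x).2 hx) _ ((he' y).2 hy)).symm
  · ext x y
    simp [Function.onFun]

theorem kendallTau_onFun (e : Equiv.Perm P) (he : ∀ x, e x ∈ S ↔ x ∈ S) (A B : P → P → Prop) :
    kendallTau S (Function.onFun A e) (Function.onFun B e) = kendallTau S A B := by
  refine Set.ncard_congr (fun p _ => (e p.1, e p.2)) ?_ ?_ ?_
  · rintro ⟨x, y⟩ ⟨hx, hy, h⟩
    exact ⟨(he x).2 hx, (he y).2 hy, h⟩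
  · rintro ⟨x, y⟩ ⟨x', y'⟩ _ _ h
    simpa using h
  · rintro ⟨x, y⟩ ⟨hx, hy, h⟩
    refine ⟨(e.symm x, e.symm y), ⟨?_, ?_, ?_⟩, by simp⟩
    · exact (he _).1 ((e.apply_symm_apply x).symm ▸ hx)
    · exact (he _).1 ((e.apply_symm_apply y).symm ▸ hy)
    · simpa [Function.onFun] using h

/-- The directed Hausdorff–Kendall-tau distance is invariant under relabelling. -/
theorem dirTau_eq_of_perm (e : Equiv.Perm P) (he : ∀ x, e x ∈ S ↔ x ∈ S)
    (h₁ : ∀ x ∈ S, ∀ y ∈ S, (R₁ (e x) (e y) ↔ R₁' x y))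
    (h₂ : ∀ x ∈ S, ∀ y ∈ S, (R₂ (e x) (e y) ↔ R₂' x y)) :
    dirTau S R₁ R₂ = dirTau S R₁' R₂' := by
  have hmin (B : P → P → Prop) :
      {m : ℕ | ∃ A, IsLinExtOn S R₁ A ∧ m = kendallTau S A B} =
        {m : ℕ | ∃ A, IsLinExtOn S R₁' A ∧ m = kendallTau S A (Function.onFun B e)} := by
    ext m
    constructor
    · rintro ⟨A, hA, rfl⟩
      exact ⟨_, hA.onFun e he h₁, (kendallTau_onFun e he A B).symm⟩
    · rintro ⟨A, hA, rfl⟩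
      obtain ⟨A, hA', rfl⟩ := exists_onFun_isLinExtOn e he h₁ hA
      exact ⟨A, hA', kendallTau_onFun e he A B⟩
  unfold dirTau
  congr 1
  ext n
  constructor
  · rintro ⟨B, hB, rfl⟩
    exact ⟨_, hB.onFun e he h₂, by rw [hmin]⟩
  · rintro ⟨B, hB, rfl⟩
    obtain ⟨B, hB', rfl⟩ := exists_onFun_isLinExtOn e he h₂ hB
    exact ⟨B, hB', by rw [hmin]⟩

end Relabelling

section Swap

variable {P : Type*} [DecidableEq P] {i : P}

theorem swap_mem_iff {F : Finset P} {j k : P} (h : j ∈ F ↔ k ∈ F) (x : P) :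
    Equiv.swap j k x ∈ F ↔ x ∈ F := by
  rw [Equiv.swap_apply_def]
  split_ifs <;> simp_all

theorem swap_mem_insert_iff {C : Finset P} {j k : P} (hj : j ∉ C) (hk : k ∉ C) (x : P) :
    Equiv.swap j k x ∈ insert j C ↔ x ∈ insert k C := by
  rw [Equiv.swap_apply_def]
  split_ifs <;> grind

theorem IsWeakOrderOn.swap_iff {F : Finset P} {R : P → P → Prop} (hR : IsWeakOrderOn F R)
    {j k : P} (h : (j ∈ F ∧ k ∈ F ∧ indiffOf R j k) ∨ (j ∉ F ∧ k ∉ F))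
    {x y : P} (hx : x ∈ F) (hy : y ∈ F) :
    R (Equiv.swap j k x) (Equiv.swap j k y) ↔ R x y := by
  obtain ⟨hj, hk, hjk, hkj⟩ | ⟨hj, hk⟩ := h
  · have hF {z : P} (hz : z ∈ F) : Equiv.swap j k z ∈ F :=
      (swap_mem_iff (iff_of_true hj hk) z).2 hz
    have hs {z : P} (hz : z ∈ F) : indiffOf R (Equiv.swap j k z) z := by
      rw [Equiv.swap_apply_def]
      split_ifs with h₁ h₂
      · exact h₁ ▸ ⟨hkj, hjk⟩
      · exact h₂ ▸ ⟨hjk, hkj⟩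
      · exact ⟨hR.refl z hz, hR.refl z hz⟩
    constructor
    · intro h
      exact hR.trans _ hx _ (hF hx) _ hy (hs hx).2
        (hR.trans _ (hF hx) _ (hF hy) _ hy h (hs hy).1)
    · intro h
      exact hR.trans _ (hF hx) _ hx _ (hF hy) (hs hx).1
        (hR.trans _ hx _ hy _ (hF hy) h (hs hy).2)
  · have hs {z : P} (hz : z ∈ F) : Equiv.swap j k z = z :=
      Equiv.swap_apply_of_ne_of_ne (ne_of_mem_of_not_mem hz hj) (ne_of_mem_of_not_mem hz hk)
    rw [hs hx, hs hy]

theorem swap_eq_iff_of_ne {i j k : P} (hj : i ≠ j) (hk : i ≠ k) (x : P) :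
    Equiv.swap j k x = i ↔ x = i := by
  rw [Equiv.swap_apply_eq_iff, Equiv.swap_apply_of_ne_of_ne hj hk]

variable (pr : FENPref P i) {j k : P} {C : Finset P}

theorem FENPref.deltaPlus_insert_eq
    (h : (j ∈ pr.friends ∧ k ∈ pr.friends ∧ indiffOf pr.Rp j k) ∨
      (j ∉ pr.friends ∧ k ∉ pr.friends))
    (hi : i ∈ C) (hj : j ∉ C) (hk : k ∉ C) :
    pr.deltaPlus (insert j C) = pr.deltaPlus (insert k C) := by
  have hF := swap_mem_iff (F := pr.friends) (j := j) (k := k) (by tauto)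
  have hs := swap_eq_iff_of_ne (ne_of_mem_of_not_mem hi hj) (ne_of_mem_of_not_mem hi hk)
  have hC := swap_mem_insert_iff hj hk
  have hR {x y : P} := pr.wo_p.swap_iff h (x := x) (y := y)
  refine dirTau_eq_of_perm (Equiv.swap j k) (fun x => ?_) (fun x _ y _ => ?_) fun x _ y _ => ?_
  · rw [Finset.mem_insert, Finset.mem_insert, hF, hs]
  · have h₁ := @hR x y
    simp only [FENPref.prefPlus, hF, hs]
    tauto
  · have h₁ := @hR x y
    have h₂ := @hR y x
    simp only [FENPref.coalPlus, hF, hs, hC]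
    clear h hF hs hC hR
    grind

theorem FENPref.deltaMinus_insert_eq
    (h : (j ∈ pr.enemies ∧ k ∈ pr.enemies ∧ indiffOf pr.Rm j k) ∨
      (j ∉ pr.enemies ∧ k ∉ pr.enemies))
    (hi : i ∈ C) (hj : j ∉ C) (hk : k ∉ C) :
    pr.deltaMinus (insert j C) = pr.deltaMinus (insert k C) := by
  have hF := swap_mem_iff (F := pr.enemies) (j := j) (k := k) (by tauto)
  have hs := swap_eq_iff_of_ne (ne_of_mem_of_not_mem hi hj) (ne_of_mem_of_not_mem hi hk)
  have hC := swap_mem_insert_iff hj hk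
  have hR {x y : P} := pr.wo_m.swap_iff h (x := x) (y := y)
  refine dirTau_eq_of_perm (Equiv.swap j k) (fun x => ?_) (fun x _ y _ => ?_) fun x _ y _ => ?_
  · rw [Finset.mem_insert, Finset.mem_insert, hF, hs]
  · have h₁ := @hR x y
    simp only [FENPref.prefMinus, hF, hs]
    tauto
  · have h₁ := @hR x y
    have h₂ := @hR y x
    simp only [FENPref.coalMinus, hF, hs, hC]
    clear h hF hs hC hR
    grind

end Swap

/-- Indifference between players: if `j ≠ k` are both friends of `i` with `j ∼_i k`,
both enemies of `i` with `j ∼_i k`, or both neutral for `i`, then for every coalition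
`C` containing `i` with `j ∉ C` and `k ∉ C`, `δ(⊵_i, C ∪ {j}) = δ(⊵_i, C ∪ {k})`,
i.e. `i` is indifferent between `C ∪ {j}` and `C ∪ {k}`. -/
theorem indifference_between_players {P : Type*} [DecidableEq P] {i : P} (pr : FENPref P i)
    (j k : P) (hjk : j ≠ k)
    (hcase :
      (j ∈ pr.friends ∧ k ∈ pr.friends ∧ indiffOf pr.Rp j k) ∨
      (j ∈ pr.enemies ∧ k ∈ pr.enemies ∧ indiffOf pr.Rm j k) ∨
      (j ∉ pr.friends ∧ j ∉ pr.enemies ∧ k ∉ pr.friends ∧ k ∉ pr.enemies))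
    (C : Finset P) (hiC : i ∈ C) (hjC : j ∉ C) (hkC : k ∉ C) :
    pr.delta (insert j C) = pr.delta (insert k C) := by
  have hd {x : P} : x ∈ pr.friends → x ∉ pr.enemies := fun hx => Finset.disjoint_left.1 pr.disj hx
  have hd' {x : P} : x ∈ pr.enemies → x ∉ pr.friends := fun hx => Finset.disjoint_right.1 pr.disj hx
  refine congrArg₂ (· + ·) (pr.deltaPlus_insert_eq ?_ hiC hjC hkC)
    (pr.deltaMinus_insert_eq ?_ hiC hjC hkC)
  · obtain h | ⟨hj, hk, -⟩ | ⟨hj, -, hk, -⟩ := hcase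
    exacts [.inl h, .inr ⟨hd' hj, hd' hk⟩, .inr ⟨hj, hk⟩]
  · obtain ⟨hj, hk, -⟩ | h | ⟨-, hj, -, hk⟩ := hcase
    exacts [.inr ⟨hd hj, hd hk⟩, .inl h, .inr ⟨hj, hk⟩]
end

section
/- Let i be a player and let A, B be coalitions containing i. If there exists an injective function φ : B ∩ N⁺_i → A ∩ N⁺_i with φ(j) ⊵_i j for every j ∈ B ∩ N⁺_i, then δ⁺(⊵_i, A) ≤ δ⁺(⊵_i, B). -/
section LinearExtensions

variable {P : Type*} {S : Finset P} {R T : P → P → Prop}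

/-- The refinement of the weak order `R` that breaks ties according to `T`. -/
def breakTies (R T : P → P → Prop) (x y : P) : Prop :=
  strictOf R x y ∨ (indiffOf R x y ∧ T x y)

/-- Breaking the ties of a weak order by a linear order gives a linear extension. -/
lemma IsLinExtOn.breakTies {R' : P → P → Prop} (hR : IsWeakOrderOn S R)
    (hT : IsLinExtOn S R' T) : IsLinExtOn S R (breakTies R T) where
  irrefl x hx h := by
    rcases h with h | h
    · exact h.2 h.1
    · exact hT.irrefl x hx h.2
  trans x hx y hy z hz hxy hyz := by
    have h1 := hR.trans x hx y hy z hz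
    have h2 := hR.trans y hy z hz x hx
    have h3 := hR.trans z hz x hx y hy
    have h4 := hR.trans z hz y hy x hx
    have h5 := hT.trans x hx y hy z hz
    simp only [_root_.breakTies, strictOf, indiffOf] at *
    tauto
  total x hx y hy hne := by
    have h1 := hR.total x hx y hy
    have h2 := hT.total x hx y hy hne
    simp only [_root_.breakTies, strictOf, indiffOf]
    tauto
  extend _ _ _ _ h := Or.inl h

lemma IsLinExtOn.asymm (hT : IsLinExtOn S R T) {x y : P} (hx : x ∈ S) (hy : y ∈ S)
    (hxy : T x y) : ¬ T y x := fun hyx =>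
  hT.irrefl x hx (hT.trans x hx y hy x hx hxy hyx)

/-- Every weak order has a linear extension. -/
lemma IsWeakOrderOn.exists_isLinExtOn (hR : IsWeakOrderOn S R) :
    ∃ T, IsLinExtOn S R T := by
  have h : IsLinExtOn S (fun _ _ => True) (WellOrderingRel : P → P → Prop) :=
    { irrefl := fun x _ => irrefl x
      trans := fun _ _ _ _ _ _ => _root_.trans
      total := fun x _ y _ hne => by
        rcases trichotomous_of WellOrderingRel x y with h | h | h
        · exact Or.inl h
        · exact absurd h hne
        · exact Or.inr h
      extend := fun _ _ _ _ h => absurd trivial h.2 }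
  exact ⟨_, h.breakTies hR⟩

/-- The least Kendall-tau distance from a linear order `T` to a linear extension of `R` is the
number of strict comparisons of `R` that `T` reverses. -/
lemma IsLinExtOn.isLeast_kendallTau {R' : P → P → Prop} (hR : IsWeakOrderOn S R)
    (hT : IsLinExtOn S R' T) :
    IsLeast {m : ℕ | ∃ A, IsLinExtOn S R A ∧ m = kendallTau S A T}
      (kendallTau S (strictOf R) T) := by
  constructor
  · refine ⟨_, hT.breakTies hR, ?_⟩
    unfold kendallTau
    congr 1
    ext ⟨x, y⟩
    have h : x ∈ S → y ∈ S → T x y → ¬ T y x := hT.asymm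
    simp only [_root_.breakTies, Set.mem_ofPred_eq]
    tauto
  · rintro m ⟨A, hA, rfl⟩
    refine Set.ncard_le_ncard ?_ ?_
    · rintro ⟨x, y⟩ ⟨hx, hy, hxy, hyx⟩
      exact ⟨hx, hy, hA.extend x hx y hy hxy, hyx⟩
    · exact (S ×ˢ S).finite_toSet.subset fun p hp =>
        Finset.mem_coe.2 (Finset.mem_product.2 ⟨hp.1, hp.2.1⟩)

end LinearExtensions

namespace FENPref

variable {P : Type*} [DecidableEq P] {i : P} (pr : FENPref P i)

lemma isWeakOrderOn_prefPlus : IsWeakOrderOn (insert i pr.friends) pr.prefPlus where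
  refl x hx := by
    have h := pr.wo_p.refl x
    simp only [Finset.mem_insert, prefPlus] at *
    tauto
  trans x hx y hy z hz hxy hyz := by
    have h := pr.wo_p.trans x
    have hi := pr.self_not_friend
    simp only [prefPlus] at *
    grind
  total x hx y hy := by
    have h := pr.wo_p.total x
    simp only [Finset.mem_insert, prefPlus] at *
    grind

lemma isWeakOrderOn_coalPlus (C : Finset P) :
    IsWeakOrderOn (insert i pr.friends) (pr.coalPlus C) where
  refl x hx := by
    have h := pr.wo_p.refl x
    simp only [Finset.mem_insert, coalPlus] at *
    tauto
  trans x hx y hy z hz hxy hyz := by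
    have h := pr.wo_p.trans x
    have h' := pr.wo_p.trans z
    have hi := pr.self_not_friend
    simp only [coalPlus] at *
    grind
  total x hx y hy := by
    have h := pr.wo_p.total x
    simp only [Finset.mem_insert, coalPlus] at *
    grind

open Classical in
/-- The number of members of `N⁺_i ∪ {i}` ranked strictly below `x` by `⊵⁺_i`. -/
noncomputable def rankPlus (x : P) : ℕ :=
  ((insert i pr.friends).filter (strictOf pr.prefPlus x)).card

lemma rankPlus_le_rankPlus {x y : P} (hx : x ∈ pr.friends) (hy : y ∈ pr.friends)
    (h : pr.Rp x y) : pr.rankPlus y ≤ pr.rankPlus x := by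
  classical
  refine Finset.card_le_card fun z hz => ?_
  rw [Finset.mem_filter] at hz ⊢
  obtain ⟨hzS, hyz, hzy⟩ := hz
  have hxS : x ∈ insert i pr.friends := Finset.mem_insert_of_mem hx
  have hyS : y ∈ insert i pr.friends := Finset.mem_insert_of_mem hy
  have hxy : pr.prefPlus x y := Or.inl ⟨hx, hy, h⟩
  exact ⟨hzS, pr.isWeakOrderOn_prefPlus.trans x hxS y hyS z hzS hxy hyz,
    fun hzx => hzy (pr.isWeakOrderOn_prefPlus.trans z hzS x hxS y hyS hzx hxy)⟩

/-- A linear extension of `C⁺_i` reverses the strict comparison `x ▷⁺_i y` iff `x ∉ C`. -/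
lemma reversed_iff {C : Finset P} {T : P → P → Prop}
    (hT : IsLinExtOn (insert i pr.friends) (pr.coalPlus C) T) {x y : P}
    (hx : x ∈ insert i pr.friends) (hy : y ∈ insert i pr.friends)
    (hxy : strictOf pr.prefPlus x y) : T y x ↔ x ∈ pr.friends \ C := by
  have hi := pr.self_not_friend
  have hF : x ∈ pr.friends := by
    simp only [strictOf, prefPlus, Finset.mem_insert] at *
    grind
  rw [Finset.mem_sdiff]
  constructor
  · refine fun hyx => ⟨hF, fun hC => hT.asymm hx hy (hT.extend x hx y hy ?_) hyx⟩
    simp only [strictOf, prefPlus, coalPlus, Finset.mem_insert] at *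
    grind
  · refine fun hC => hT.extend y hy x hx ?_
    simp only [strictOf, prefPlus, coalPlus, Finset.mem_insert] at *
    grind

lemma kendallTau_eq_sum_rankPlus {C : Finset P} {T : P → P → Prop}
    (hT : IsLinExtOn (insert i pr.friends) (pr.coalPlus C) T) :
    kendallTau (insert i pr.friends) (strictOf pr.prefPlus) T =
      ∑ x ∈ pr.friends \ C, pr.rankPlus x := by
  classical
  have hset : {p : P × P | p.1 ∈ insert i pr.friends ∧ p.2 ∈ insert i pr.friends ∧
      strictOf pr.prefPlus p.1 p.2 ∧ T p.2 p.1} =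
      ↑(((pr.friends \ C) ×ˢ insert i pr.friends).filter
        fun p => strictOf pr.prefPlus p.1 p.2) := by
    ext ⟨x, y⟩
    simp only [Set.mem_ofPred_eq, Finset.coe_filter, Finset.mem_product]
    constructor
    · rintro ⟨hx, hy, hxy, hyx⟩
      exact ⟨⟨(pr.reversed_iff hT hx hy hxy).1 hyx, hy⟩, hxy⟩
    · rintro ⟨⟨hxC, hy⟩, hxy⟩
      have hx : x ∈ insert i pr.friends :=
        Finset.mem_insert_of_mem (Finset.mem_sdiff.1 hxC).1
      exact ⟨hx, hy, hxy, (pr.reversed_iff hT hx hy hxy).2 hxC⟩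
  rw [kendallTau, hset, Set.ncard_coe_finset, Finset.card_filter, Finset.sum_product]
  exact Finset.sum_congr rfl fun x _ => by rw [rankPlus, Finset.card_filter]

/-- `δ⁺(⊵_i, C)` is the sum over the friends `x` outside `C` of the number of members of
`N⁺_i ∪ {i}` strictly below `x`. -/
lemma deltaPlus_eq_sum_rankPlus (C : Finset P) :
    pr.deltaPlus C = ∑ x ∈ pr.friends \ C, pr.rankPlus x := by
  have hmin {T : P → P → Prop} (hT : IsLinExtOn (insert i pr.friends) (pr.coalPlus C) T) :
      sInf {m : ℕ | ∃ A, IsLinExtOn (insert i pr.friends) pr.prefPlus A ∧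
        m = kendallTau (insert i pr.friends) A T} = ∑ x ∈ pr.friends \ C, pr.rankPlus x :=
    (hT.isLeast_kendallTau pr.isWeakOrderOn_prefPlus).csInf_eq.trans
      (pr.kendallTau_eq_sum_rankPlus hT)
  obtain ⟨T, hT⟩ := (pr.isWeakOrderOn_coalPlus C).exists_isLinExtOn
  refine IsGreatest.csSup_eq ⟨⟨T, hT, (hmin hT).symm⟩, ?_⟩
  rintro n ⟨T', hT', rfl⟩
  exact (hmin hT').le

end FENPref

/-- If there is an injection `φ : B ∩ N⁺_i → A ∩ N⁺_i` with `φ(j) ⊵_i j` for every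
`j ∈ B ∩ N⁺_i`, then `δ⁺(⊵_i, A) ≤ δ⁺(⊵_i, B)`. -/
theorem deltaPlus_mono {P : Type*} [DecidableEq P] {i : P} (pr : FENPref P i)
    (A B : Finset P) (hiA : i ∈ A) (hiB : i ∈ B) (φ : P → P)
    (hmaps : ∀ j ∈ B ∩ pr.friends, φ j ∈ A ∩ pr.friends)
    (hinj : Set.InjOn φ ↑(B ∩ pr.friends))
    (hpref : ∀ j ∈ B ∩ pr.friends, pr.Rp (φ j) j) :
    pr.deltaPlus A ≤ pr.deltaPlus B := by
  have hle : ∑ j ∈ B ∩ pr.friends, pr.rankPlus j ≤ ∑ j ∈ A ∩ pr.friends, pr.rankPlus j :=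
    calc ∑ j ∈ B ∩ pr.friends, pr.rankPlus j
        ≤ ∑ j ∈ B ∩ pr.friends, pr.rankPlus (φ j) :=
          Finset.sum_le_sum fun j hj => pr.rankPlus_le_rankPlus
            (Finset.mem_inter.1 (hmaps j hj)).2 (Finset.mem_inter.1 hj).2 (hpref j hj)
      _ = ∑ j ∈ (B ∩ pr.friends).image φ, pr.rankPlus j := (Finset.sum_image hinj).symm
      _ ≤ ∑ j ∈ A ∩ pr.friends, pr.rankPlus j :=
          Finset.sum_le_sum_of_subset (Finset.image_subset_iff.2 hmaps)
  have hA := Finset.sum_inter_add_sum_sdiff pr.friends A pr.rankPlus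
  have hB := Finset.sum_inter_add_sum_sdiff pr.friends B pr.rankPlus
  rw [pr.deltaPlus_eq_sum_rankPlus, pr.deltaPlus_eq_sum_rankPlus]
  rw [Finset.inter_comm] at hA hB
  omega
end
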